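/- Fix T ∈ ℝ^m_{>0} and set V = T^1⋯T^m. Let f : ℝ^d → ℝ be continuous and bounded, and define w(t,x) = ∫_{ℝ^d} f(y) L(t;x,y) dy for t ∈ ℝ^m_{>0} with v = t^1⋯t^m < V and x ∈ ℝ^d, where L(t;x,y) = (2π(V − v))^{−d/2} exp(−‖x−y‖²/(2(V − v))). Then w satisfies the backward multitime heat PDEs ∂w/∂t^α (t,x) = −(1/2) c_α(t) Δ_x w(t,x) for every α = 1,…,m on {t ∈ ℝ^m_{>0} : t^1⋯t^m < V} × ℝ^d, and w satisfies the terminal condition: for every x ∈ ℝ^d, w(t', y) → f(x) whenever (t', y) → (t, x) with t'^1⋯t'^m → V⁻. -/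

import Mathlib

open Real Finset MeasureTheory Filter

/-- Laplacian in the `x`-variables: `Σ_a ∂²f/∂(x^a)²`. -/
noncomputable def lapX {d : ℕ} (f : (Fin d → ℝ) → ℝ) (x : Fin d → ℝ) : ℝ :=
  ∑ a : Fin d, deriv (deriv (fun s => f (Function.update x a s))) (x a)

/-- The backward Gaussian kernel
`L(t;x,y) = (2π(V - v))^{-d/2} exp(-‖x-y‖²/(2(V - v)))`, `v = t^1⋯t^m`. -/
noncomputable def gaussL (m d : ℕ) (V : ℝ) (t : Fin m → ℝ) (x y : Fin d → ℝ) : ℝ :=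
  (2 * π * (V - ∏ α, t α)) ^ (-(d : ℝ) / 2) *
    Real.exp (-(∑ a, (x a - y a) ^ 2) / (2 * (V - ∏ α, t α)))

/-- The backward mean value `w(t,x) = ∫_{ℝ^d} f(y) L(t;x,y) dy`. -/
noncomputable def meanValW (m d : ℕ) (V : ℝ) (f : (Fin d → ℝ) → ℝ)
    (t : Fin m → ℝ) (x : Fin d → ℝ) : ℝ :=
  ∫ y : Fin d → ℝ, f y * gaussL m d V t x y

section GaussianIntegrals

variable {d : ℕ}

theorem integrable_exp_neg_mul_sum_sq {c : ℝ} (hc : 0 < c) (x : Fin d → ℝ) :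
    Integrable fun y : Fin d → ℝ => Real.exp (-(c * ∑ a, (x a - y a) ^ 2)) := by
  have h : Integrable fun y : Fin d → ℝ => ∏ a, Real.exp (-c * (x a - y a) ^ 2) := by
    refine Integrable.fintype_prod (f := fun a r => Real.exp (-c * (x a - r) ^ 2)) fun a => ?_
    exact (integrable_exp_neg_mul_sq hc).comp_sub_left (x a)
  refine h.congr (Eventually.of_forall fun y => ?_)
  simp only [← Real.exp_sum, Finset.mul_sum, Finset.sum_neg_distrib, neg_mul]

theorem integral_exp_neg_half_sum_sq :
    ∫ z : Fin d → ℝ, Real.exp (-(∑ a, z a ^ 2) / 2) = (2 * π) ^ ((d : ℝ) / 2) := by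
  have h : ∀ z : Fin d → ℝ, Real.exp (-(∑ a, z a ^ 2) / 2)
      = ∏ a, Real.exp (-(1 / 2) * z a ^ 2) := by
    intro z
    rw [← Real.exp_sum, ← Finset.mul_sum]
    ring_nf
  simp_rw [h]
  rw [integral_fintype_prod_volume_eq_prod (fun _ r => Real.exp (-(1 / 2) * r ^ 2))]
  simp only [integral_gaussian, Finset.prod_const, Finset.card_univ, Fintype.card_fin]
  rw [Real.sqrt_eq_rpow, ← Real.rpow_natCast, ← Real.rpow_mul (by positivity)]
  congr 1 <;> ring

theorem one_add_mul_exp_le {σ₀ σ q q₀ : ℝ} (hσ : 0 < σ) (hσ₀ : σ ≤ 2 * σ₀) (hq : 0 ≤ q)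
    (hqq : q₀ ≤ 2 * q + 2) :
    (1 + q) * Real.exp (-q / (2 * σ))
      ≤ (1 + 8 * σ₀) * Real.exp (1 / (8 * σ₀)) * Real.exp (-(1 / (16 * σ₀) * q₀)) := by
  have h0 : 0 < σ₀ := by linarith
  have h1 : -q / (2 * σ) ≤ -q / (8 * σ₀) + -q / (8 * σ₀) := by
    have : q / (4 * σ₀) ≤ q / (2 * σ) :=
      div_le_div_of_nonneg_left hq (by positivity) (by linarith)
    have e : -q / (8 * σ₀) + -q / (8 * σ₀) = -(q / (4 * σ₀)) := by field_simp; ring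
    rw [e, neg_div]; linarith
  have h2 : 1 + q ≤ (1 + 8 * σ₀) * Real.exp (q / (8 * σ₀)) := by
    have := Real.add_one_le_exp (q / (8 * σ₀))
    calc 1 + q ≤ (1 + 8 * σ₀) * (q / (8 * σ₀) + 1) := by
          have : (1 + 8 * σ₀) * (q / (8 * σ₀) + 1) = 1 + q + (q / (8 * σ₀) + 8 * σ₀) := by
            field_simp; ring
          rw [this]
          have : 0 ≤ q / (8 * σ₀) + 8 * σ₀ := by positivity
          linarith
      _ ≤ _ := by gcongr
  calc (1 + q) * Real.exp (-q / (2 * σ))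
      ≤ ((1 + 8 * σ₀) * Real.exp (q / (8 * σ₀))) *
          Real.exp (-q / (8 * σ₀) + -q / (8 * σ₀)) := by gcongr
    _ = (1 + 8 * σ₀) * Real.exp (-q / (8 * σ₀)) := by
        rw [mul_assoc, ← Real.exp_add]; congr 2; ring
    _ ≤ (1 + 8 * σ₀) * Real.exp (1 / (8 * σ₀) + -(1 / (16 * σ₀) * q₀)) := by
        gcongr
        have : 1 / (8 * σ₀) + -(1 / (16 * σ₀) * q₀) - -q / (8 * σ₀)
          = (2 * q + 2 - q₀) / (16 * σ₀) := by field_simp; ring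
        have : 0 ≤ (2 * q + 2 - q₀) / (16 * σ₀) := div_nonneg (by linarith) (by positivity)
        linarith
    _ = _ := by rw [Real.exp_add, mul_assoc]

theorem integrable_mul_of_le_gaussian {f g : (Fin d → ℝ) → ℝ} (hf : Continuous f) {C : ℝ}
    (hC : ∀ y, |f y| ≤ C) (hg : Continuous g) {c K : ℝ} (hc : 0 < c) (x : Fin d → ℝ)
    (hgb : ∀ y, |g y| ≤ K * Real.exp (-(c * ∑ a, (x a - y a) ^ 2))) :
    Integrable fun y => f y * g y := by
  refine ((integrable_exp_neg_mul_sum_sq hc x).const_mul (C * K)).mono'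
    (hf.mul hg).aestronglyMeasurable (Eventually.of_forall fun y => ?_)
  rw [Real.norm_eq_abs, abs_mul, mul_assoc]
  exact mul_le_mul (hC y) (hgb y) (abs_nonneg _) ((abs_nonneg _).trans (hC y))

theorem hasDerivAt_integral_mul_of_le_gaussian {f : (Fin d → ℝ) → ℝ} (hf : Continuous f) {C : ℝ}
    (hC : ∀ y, |f y| ≤ C) {E E' : ℝ → (Fin d → ℝ) → ℝ} (hE : ∀ s, Continuous (E s))
    (hE' : ∀ s, Continuous (E' s)) {c K ε s₀ : ℝ} (hc : 0 < c) (hε : 0 < ε) (x : Fin d → ℝ)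
    (hb : ∀ s ∈ Metric.ball s₀ ε, ∀ y,
      |E s y| ≤ K * Real.exp (-(c * ∑ a, (x a - y a) ^ 2)))
    (hb' : ∀ s ∈ Metric.ball s₀ ε, ∀ y,
      |E' s y| ≤ K * Real.exp (-(c * ∑ a, (x a - y a) ^ 2)))
    (hd : ∀ s ∈ Metric.ball s₀ ε, ∀ y, HasDerivAt (fun s => E s y) (E' s y) s) :
    HasDerivAt (fun s => ∫ y, f y * E s y) (∫ y, f y * E' s₀ y) s₀ := by
  have h0 := Metric.mem_ball_self (x := s₀) hε
  refine (hasDerivAt_integral_of_dominated_loc_of_deriv_le (F := fun s y => f y * E s y)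
    (F' := fun s y => f y * E' s y) (Metric.ball_mem_nhds s₀ hε)
    (Eventually.of_forall fun s => (hf.mul (hE s)).aestronglyMeasurable)
    (integrable_mul_of_le_gaussian hf hC (hE s₀) hc x (hb s₀ h0))
    (hf.mul (hE' s₀)).aestronglyMeasurable
    (Eventually.of_forall fun y s hs => ?_)
    ((integrable_exp_neg_mul_sum_sq hc x).const_mul (C * K))
    (Eventually.of_forall fun y s hs => (hd s hs y).const_mul (f y))).2
  rw [Real.norm_eq_abs, abs_mul, mul_assoc]
  exact mul_le_mul (hC y) (hb' s hs y) (abs_nonneg _) ((abs_nonneg _).trans (hC y))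

theorem abs_mul_exp_le {σ₀ σ q q₀ p M : ℝ} (hσ : 0 < σ) (hσ₀ : σ ≤ 2 * σ₀) (hq : 0 ≤ q)
    (hqq : q₀ ≤ 2 * q + 2) (hM : 0 ≤ M) (hp : |p| ≤ M * (1 + q)) :
    |p * Real.exp (-q / (2 * σ))|
      ≤ M * ((1 + 8 * σ₀) * Real.exp (1 / (8 * σ₀))) * Real.exp (-(1 / (16 * σ₀) * q₀)) := by
  rw [abs_mul, Real.abs_exp]
  calc |p| * Real.exp (-q / (2 * σ)) ≤ M * (1 + q) * Real.exp (-q / (2 * σ)) := by gcongr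
    _ = M * ((1 + q) * Real.exp (-q / (2 * σ))) := by ring
    _ ≤ M * ((1 + 8 * σ₀) * Real.exp (1 / (8 * σ₀)) * Real.exp (-(1 / (16 * σ₀) * q₀))) :=
        mul_le_mul_of_nonneg_left (one_add_mul_exp_le hσ hσ₀ hq hqq) hM
    _ = _ := by ring

theorem sum_update_sub_sq (x y : Fin d → ℝ) (a : Fin d) (s : ℝ) :
    ∑ b, (Function.update x a s b - y b) ^ 2
      = (s - y a) ^ 2 + ∑ b ∈ univ.erase a, (x b - y b) ^ 2 := by
  rw [← Finset.add_sum_erase _ _ (Finset.mem_univ a), Function.update_self]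
  congr 1
  refine Finset.sum_congr rfl fun b hb => ?_
  rw [Function.update_of_ne (Finset.ne_of_mem_erase hb)]

theorem sub_sq_le_sum_update_sub_sq (x y : Fin d → ℝ) (a : Fin d) (s : ℝ) :
    (s - y a) ^ 2 ≤ ∑ b, (Function.update x a s b - y b) ^ 2 := by
  rw [sum_update_sub_sq]
  exact le_add_of_nonneg_right (Finset.sum_nonneg fun _ _ => sq_nonneg _)

theorem sum_update_sub_sq_le (x y : Fin d → ℝ) (a : Fin d) {s s₀ : ℝ}
    (hs : s ∈ Metric.ball s₀ 1) :
    ∑ b, (Function.update x a s₀ b - y b) ^ 2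
      ≤ 2 * (∑ b, (Function.update x a s b - y b) ^ 2) + 2 := by
  rw [sum_update_sub_sq, sum_update_sub_sq]
  have hR : 0 ≤ ∑ b ∈ univ.erase a, (x b - y b) ^ 2 := Finset.sum_nonneg fun _ _ => sq_nonneg _
  rw [Metric.mem_ball, Real.dist_eq, abs_lt] at hs
  have : (s - s₀) ^ 2 ≤ 1 := by nlinarith
  nlinarith [sq_nonneg ((s - y a) + (s - s₀))]

theorem hasDerivAt_exp_update (x y : Fin d → ℝ) (a : Fin d) (σ s : ℝ) :
    HasDerivAt (fun s => Real.exp (-(∑ b, (Function.update x a s b - y b) ^ 2) / (2 * σ)))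
      (-(s - y a) / σ *
        Real.exp (-(∑ b, (Function.update x a s b - y b) ^ 2) / (2 * σ))) s := by
  simp_rw [sum_update_sub_sq]
  generalize ∑ b ∈ univ.erase a, (x b - y b) ^ 2 = R
  have h := (((((hasDerivAt_id s).sub_const (y a)).pow 2).add_const R).neg.div_const (2 * σ)).exp
  refine h.congr_deriv ?_
  simp only [id, Pi.neg_apply, Pi.pow_apply]
  push_cast
  ring

theorem abs_neg_div_le {r q σ : ℝ} (hσ : 0 < σ) (hr : r ^ 2 ≤ q) :
    |-r / σ| ≤ 1 / σ * (1 + q) := by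
  have h : |r| ≤ 1 + q := by
    rw [← sq_abs] at hr
    nlinarith [sq_nonneg (|r| - 1), abs_nonneg r]
  rw [abs_div, abs_neg, abs_of_pos hσ, div_eq_mul_one_div, mul_comm]
  gcongr

variable {f : (Fin d → ℝ) → ℝ} {C : ℝ}

theorem hasDerivAt_integral_exp_update (hf : Continuous f) (hC : ∀ y, |f y| ≤ C)
    (x : Fin d → ℝ) (a : Fin d) {σ : ℝ} (hσ : 0 < σ) (s₀ : ℝ) :
    HasDerivAt (fun s => ∫ y, f y *
        Real.exp (-(∑ b, (Function.update x a s b - y b) ^ 2) / (2 * σ)))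
      (∫ y, f y * (-(s₀ - y a) / σ *
        Real.exp (-(∑ b, (Function.update x a s₀ b - y b) ^ 2) / (2 * σ)))) s₀ := by
  refine hasDerivAt_integral_mul_of_le_gaussian hf hC
    (E := fun s y => Real.exp (-(∑ b, (Function.update x a s b - y b) ^ 2) / (2 * σ)))
    (E' := fun s y => -(s - y a) / σ *
        Real.exp (-(∑ b, (Function.update x a s b - y b) ^ 2) / (2 * σ)))
    (c := 1 / (16 * σ)) (K := (1 + 1 / σ) * ((1 + 8 * σ) * Real.exp (1 / (8 * σ))))
    (by fun_prop) (by fun_prop) (by positivity) one_pos (Function.update x a s₀) ?_ ?_ ?_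
  · intro s hs y
    have := abs_mul_exp_le (p := 1) (M := 1 + 1 / σ) hσ (by linarith : σ ≤ 2 * σ)
      (Finset.sum_nonneg fun _ _ => sq_nonneg _) (sum_update_sub_sq_le x y a hs) (by positivity) ?_
    · simpa only [one_mul] using this
    · rw [abs_one]
      have h1 : 0 ≤ 1 / σ := by positivity
      have h2 := (sq_nonneg _).trans (sub_sq_le_sum_update_sub_sq x y a s)
      nlinarith
  · intro s hs y
    refine abs_mul_exp_le hσ (by linarith : σ ≤ 2 * σ)
      (Finset.sum_nonneg fun _ _ => sq_nonneg _) (sum_update_sub_sq_le x y a hs) (by positivity) ?_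
    have h2 := sub_sq_le_sum_update_sub_sq x y a s
    have h3 := (sq_nonneg _).trans h2
    refine (abs_neg_div_le hσ h2).trans ?_
    gcongr
    linarith
  · exact fun s _ y => hasDerivAt_exp_update x y a σ s

theorem abs_sq_div_sub_le {r q σ : ℝ} (hσ : 0 < σ) (hr : r ^ 2 ≤ q) :
    |r ^ 2 / σ ^ 2 - 1 / σ| ≤ (1 / σ ^ 2 + 1 / σ) * (1 + q) := by
  have h1 : 0 ≤ 1 / σ := by positivity
  have h2 : 0 ≤ 1 / σ ^ 2 := by positivity
  have h3 : r ^ 2 / σ ^ 2 = 1 / σ ^ 2 * r ^ 2 := by ring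
  have h4 := mul_le_mul_of_nonneg_left hr h2
  have h5 : 0 ≤ q := (sq_nonneg r).trans hr
  have h6 := mul_nonneg h1 h5
  have h7 := mul_nonneg h2 (sq_nonneg r)
  rw [h3, abs_le]
  constructor <;> nlinarith

theorem hasDerivAt_integral_mul_exp_update (hf : Continuous f) (hC : ∀ y, |f y| ≤ C)
    (x : Fin d → ℝ) (a : Fin d) {σ : ℝ} (hσ : 0 < σ) (s₀ : ℝ) :
    HasDerivAt (fun s => ∫ y, f y * (-(s - y a) / σ *
        Real.exp (-(∑ b, (Function.update x a s b - y b) ^ 2) / (2 * σ))))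
      (∫ y, f y * (((s₀ - y a) ^ 2 / σ ^ 2 - 1 / σ) *
        Real.exp (-(∑ b, (Function.update x a s₀ b - y b) ^ 2) / (2 * σ)))) s₀ := by
  refine hasDerivAt_integral_mul_of_le_gaussian hf hC
    (E := fun s y => -(s - y a) / σ *
        Real.exp (-(∑ b, (Function.update x a s b - y b) ^ 2) / (2 * σ)))
    (E' := fun s y => ((s - y a) ^ 2 / σ ^ 2 - 1 / σ) *
        Real.exp (-(∑ b, (Function.update x a s b - y b) ^ 2) / (2 * σ)))
    (c := 1 / (16 * σ))
    (K := (1 / σ ^ 2 + 1 / σ) * ((1 + 8 * σ) * Real.exp (1 / (8 * σ))))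
    (by fun_prop) (by fun_prop) (by positivity) one_pos (Function.update x a s₀) ?_ ?_ ?_
  · intro s hs y
    refine abs_mul_exp_le hσ (by linarith : σ ≤ 2 * σ)
      (Finset.sum_nonneg fun _ _ => sq_nonneg _) (sum_update_sub_sq_le x y a hs) (by positivity) ?_
    have h2 := sub_sq_le_sum_update_sub_sq x y a s
    have h3 := (sq_nonneg _).trans h2
    have h4 : 0 ≤ 1 / σ ^ 2 := by positivity
    refine (abs_neg_div_le hσ h2).trans ?_
    gcongr
    linarith
  · intro s hs y
    exact abs_mul_exp_le hσ (by linarith : σ ≤ 2 * σ)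
      (Finset.sum_nonneg fun _ _ => sq_nonneg _) (sum_update_sub_sq_le x y a hs) (by positivity)
      (abs_sq_div_sub_le hσ (sub_sq_le_sum_update_sub_sq x y a s))
  · intro s _ y
    have h := ((((hasDerivAt_id s).sub_const (y a)).neg.div_const σ)).mul
      (hasDerivAt_exp_update x y a σ s)
    refine h.congr_deriv ?_
    simp only [id, Pi.neg_apply]
    field_simp
    ring

theorem integrable_mul_sq_sub_mul_exp (hf : Continuous f) (hC : ∀ y, |f y| ≤ C)
    (x : Fin d → ℝ) (a : Fin d) {σ : ℝ} (hσ : 0 < σ) :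
    Integrable fun y => f y * (((x a - y a) ^ 2 / σ ^ 2 - 1 / σ) *
      Real.exp (-(∑ b, (x b - y b) ^ 2) / (2 * σ))) := by
  refine integrable_mul_of_le_gaussian hf hC (by fun_prop) (c := 1 / (16 * σ))
    (K := (1 / σ ^ 2 + 1 / σ) * ((1 + 8 * σ) * Real.exp (1 / (8 * σ)))) (by positivity) x
    fun y => ?_
  have h0 : 0 ≤ ∑ b, (x b - y b) ^ 2 := Finset.sum_nonneg fun _ _ => sq_nonneg _
  have h := sub_sq_le_sum_update_sub_sq x y a (x a)
  rw [Function.update_eq_self] at h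
  exact abs_mul_exp_le hσ (by linarith : σ ≤ 2 * σ) h0 (by linarith) (by positivity)
    (abs_sq_div_sub_le hσ h)

theorem integrable_mul_exp (hf : Continuous f) (hC : ∀ y, |f y| ≤ C)
    (x : Fin d → ℝ) {σ : ℝ} (hσ : 0 < σ) :
    Integrable fun y => f y * Real.exp (-(∑ b, (x b - y b) ^ 2) / (2 * σ)) := by
  refine integrable_mul_of_le_gaussian hf hC (by fun_prop) (c := 1 / (2 * σ)) (K := 1)
    (by positivity) x fun y => ?_
  rw [Real.abs_exp, one_mul, neg_div, div_eq_mul_one_div, mul_comm]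

theorem hasDerivAt_integral_exp_variance (hf : Continuous f) (hC : ∀ y, |f y| ≤ C)
    (x : Fin d → ℝ) {σ₀ : ℝ} (hσ₀ : 0 < σ₀) :
    HasDerivAt (fun σ => ∫ y, f y * Real.exp (-(∑ b, (x b - y b) ^ 2) / (2 * σ)))
      (∫ y, f y * ((∑ b, (x b - y b) ^ 2) / (2 * σ₀ ^ 2) *
        Real.exp (-(∑ b, (x b - y b) ^ 2) / (2 * σ₀)))) σ₀ := by
  have hball : ∀ σ ∈ Metric.ball σ₀ (σ₀ / 2), σ₀ / 2 < σ ∧ σ ≤ 2 * σ₀ := by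
    intro σ hσ
    rw [Metric.mem_ball, Real.dist_eq, abs_lt] at hσ
    constructor <;> linarith
  refine hasDerivAt_integral_mul_of_le_gaussian hf hC
    (E := fun σ y => Real.exp (-(∑ b, (x b - y b) ^ 2) / (2 * σ)))
    (E' := fun σ y => (∑ b, (x b - y b) ^ 2) / (2 * σ ^ 2) *
        Real.exp (-(∑ b, (x b - y b) ^ 2) / (2 * σ)))
    (c := 1 / (16 * σ₀))
    (K := (1 + 2 / σ₀ ^ 2) * ((1 + 8 * σ₀) * Real.exp (1 / (8 * σ₀))))
    (by fun_prop) (by fun_prop) (by positivity) (half_pos hσ₀) x ?_ ?_ ?_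
  · intro σ hσ y
    obtain ⟨h1, h2⟩ := hball σ hσ
    have h0 : 0 ≤ ∑ b, (x b - y b) ^ 2 := Finset.sum_nonneg fun _ _ => sq_nonneg _
    have := abs_mul_exp_le (p := 1) (M := 1 + 2 / σ₀ ^ 2) (by linarith) h2 h0
      (by linarith : ∑ b, (x b - y b) ^ 2 ≤ _) (by positivity) ?_
    · simpa only [one_mul] using this
    · rw [abs_one]
      have h3 : 0 ≤ 2 / σ₀ ^ 2 := by positivity
      nlinarith
  · intro σ hσ y
    obtain ⟨h1, h2⟩ := hball σ hσ
    have h0 : 0 ≤ ∑ b, (x b - y b) ^ 2 := Finset.sum_nonneg fun _ _ => sq_nonneg _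
    refine abs_mul_exp_le (by linarith) h2 h0 (by linarith) (by positivity) ?_
    have h3 : 1 / (2 * σ ^ 2) ≤ 2 / σ₀ ^ 2 := by
      rw [div_le_div_iff₀ (by nlinarith) (by positivity)]
      nlinarith
    have h4 : 0 ≤ 1 / (2 * σ ^ 2) := by positivity
    rw [abs_of_nonneg (by positivity), div_eq_mul_one_div, mul_comm]
    exact mul_le_mul (by linarith) (by linarith) h0 (by linarith)
  · intro σ hσ y
    have hσ0 : σ ≠ 0 := by linarith [(hball σ hσ).1]
    have h := ((hasDerivAt_const σ (-(∑ b, (x b - y b) ^ 2))).div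
      ((hasDerivAt_id σ).const_mul 2) (by simpa using hσ0)).exp
    refine h.congr_deriv ?_
    simp only [id, Pi.div_apply]
    field_simp
    ring

end GaussianIntegrals

/-- The convolution of `f` with the centred Gaussian of variance `σ`, as a function of `σ`. -/
noncomputable def heatMean {d : ℕ} (f : (Fin d → ℝ) → ℝ) (σ : ℝ) (x : Fin d → ℝ) : ℝ :=
  (2 * π * σ) ^ (-(d : ℝ) / 2) *
    ∫ y, f y * Real.exp (-(∑ b, (x b - y b) ^ 2) / (2 * σ))

theorem meanValW_eq_heatMean (m d : ℕ) (V : ℝ) (f : (Fin d → ℝ) → ℝ) (t : Fin m → ℝ)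
    (x : Fin d → ℝ) : meanValW m d V f t x = heatMean f (V - ∏ α, t α) x := by
  rw [meanValW, heatMean, ← integral_const_mul]
  simp only [gaussL]
  congr 1 with y
  ring

section HeatMean

variable {d : ℕ} {f : (Fin d → ℝ) → ℝ} {C : ℝ}

theorem lapX_heatMean (hf : Continuous f) (hC : ∀ y, |f y| ≤ C) (x : Fin d → ℝ) {σ : ℝ}
    (hσ : 0 < σ) :
    lapX (heatMean f σ) x = (2 * π * σ) ^ (-(d : ℝ) / 2) *
      ∑ a, ∫ y, f y * (((x a - y a) ^ 2 / σ ^ 2 - 1 / σ) *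
        Real.exp (-(∑ b, (x b - y b) ^ 2) / (2 * σ))) := by
  rw [lapX, Finset.mul_sum]
  refine Finset.sum_congr rfl fun a _ => ?_
  have h1 : deriv (fun s => heatMean f σ (Function.update x a s)) = fun s =>
      (2 * π * σ) ^ (-(d : ℝ) / 2) * ∫ y, f y * (-(s - y a) / σ *
        Real.exp (-(∑ b, (Function.update x a s b - y b) ^ 2) / (2 * σ))) :=
    funext fun s => ((hasDerivAt_integral_exp_update hf hC x a hσ s).const_mul _).deriv
  rw [h1, ((hasDerivAt_integral_mul_exp_update hf hC x a hσ (x a)).const_mul _).deriv,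
    Function.update_eq_self]

theorem hasDerivAt_heatMean (hf : Continuous f) (hC : ∀ y, |f y| ≤ C) (x : Fin d → ℝ) {σ : ℝ}
    (hσ : 0 < σ) :
    HasDerivAt (fun σ => heatMean f σ x) (1 / 2 * lapX (heatMean f σ) x) σ := by
  have hsum : ∑ a, ∫ y, f y * (((x a - y a) ^ 2 / σ ^ 2 - 1 / σ) *
        Real.exp (-(∑ b, (x b - y b) ^ 2) / (2 * σ)))
      = 2 * (∫ y, f y * ((∑ b, (x b - y b) ^ 2) / (2 * σ ^ 2) *
        Real.exp (-(∑ b, (x b - y b) ^ 2) / (2 * σ))))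
        - d / σ * ∫ y, f y * Real.exp (-(∑ b, (x b - y b) ^ 2) / (2 * σ)) := by
    have hI := integrable_finsetSum univ fun a _ => integrable_mul_sq_sub_mul_exp hf hC x a hσ
    rw [← integral_finsetSum _ fun a _ => integrable_mul_sq_sub_mul_exp hf hC x a hσ,
      eq_sub_iff_add_eq, ← integral_const_mul, ← integral_const_mul,
      ← integral_add hI ((integrable_mul_exp hf hC x hσ).const_mul _)]
    congr 1 with y
    rw [← Finset.mul_sum, ← Finset.sum_mul, Finset.sum_sub_distrib, ← Finset.sum_div,
      Finset.sum_const, Finset.card_univ, Fintype.card_fin, nsmul_eq_mul]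
    field_simp
    ring
  have hp : HasDerivAt (fun σ : ℝ => (2 * π * σ) ^ (-(d : ℝ) / 2))
      (-(d : ℝ) / (2 * σ) * (2 * π * σ) ^ (-(d : ℝ) / 2)) σ := by
    have hpos : 0 < 2 * π * σ := by positivity
    have h := ((hasDerivAt_id σ).const_mul (2 * π)).rpow_const (p := -(d : ℝ) / 2)
      (Or.inl hpos.ne')
    refine h.congr_deriv ?_
    simp only [id]
    rw [Real.rpow_sub_one hpos.ne']
    field_simp
  refine (hp.mul (hasDerivAt_integral_exp_variance hf hC x hσ)).congr_deriv ?_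
  rw [lapX_heatMean hf hC x hσ, hsum]
  field_simp
  ring

theorem heatMean_eq_integral_add_sqrt_smul (f : (Fin d → ℝ) → ℝ) (x : Fin d → ℝ) {σ : ℝ}
    (hσ : 0 < σ) :
    heatMean f σ x = (2 * π) ^ (-(d : ℝ) / 2) *
      ∫ z, f (x + √σ • z) * Real.exp (-(∑ b, z b ^ 2) / 2) := by
  have hs : 0 < √σ := Real.sqrt_pos.2 hσ
  have h1 := Measure.integral_comp_smul volume (fun y : Fin d → ℝ =>
    f (x + y) * Real.exp (-(∑ b, y b ^ 2) / (2 * σ))) (√σ)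
  have h2 := integral_add_left_eq_self (μ := volume) (fun y : Fin d → ℝ =>
    f y * Real.exp (-(∑ b, (x b - y b) ^ 2) / (2 * σ))) x
  simp only [Pi.add_apply, sub_add_cancel_left, neg_sq] at h2
  have h3 : ∀ z : Fin d → ℝ,
      -(∑ b, (√σ • z) b ^ 2) / (2 * σ) = -(∑ b, z b ^ 2) / 2 := by
    intro z
    simp only [Pi.smul_apply, smul_eq_mul, mul_pow, Real.sq_sqrt hσ.le, ← Finset.mul_sum]
    field_simp
  simp only [h3, h2, Module.finrank_fin_fun, smul_eq_mul] at h1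
  rw [heatMean, h1, abs_of_pos (by positivity), Real.mul_rpow (by positivity) hσ.le, mul_assoc]
  congr 2
  rw [neg_div, Real.rpow_neg hσ.le, Real.sqrt_eq_rpow, ← Real.rpow_natCast, ← Real.rpow_mul hσ.le]
  congr 2
  ring

theorem tendsto_heatMean (hf : Continuous f) (hC : ∀ y, |f y| ≤ C) {ι : Type*} {l : Filter ι}
    [l.IsCountablyGenerated] {σ : ι → ℝ} {ys : ι → Fin d → ℝ} {x : Fin d → ℝ}
    (hpos : ∀ᶠ k in l, 0 < σ k) (hσ : Tendsto σ l (nhds 0)) (hy : Tendsto ys l (nhds x)) :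
    Tendsto (fun k => heatMean f (σ k) (ys k)) l (nhds (f x)) := by
  have hint : Integrable fun z : Fin d → ℝ => Real.exp (-(∑ b, z b ^ 2) / 2) := by
    refine (integrable_exp_neg_mul_sum_sq (c := 1 / 2) (by norm_num) (0 : Fin d → ℝ)).congr
      (Eventually.of_forall fun z => ?_)
    simp only [Pi.zero_apply, zero_sub, neg_sq]
    ring_nf
  have hlim : Tendsto (fun k => ∫ z, f (ys k + √(σ k) • z) * Real.exp (-(∑ b, z b ^ 2) / 2)) l
      (nhds (∫ z : Fin d → ℝ, f x * Real.exp (-(∑ b, z b ^ 2) / 2))) := by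
    refine tendsto_integral_filter_of_dominated_convergence
      (fun z => C * Real.exp (-(∑ b, z b ^ 2) / 2))
      (Eventually.of_forall fun k => Continuous.aestronglyMeasurable (by fun_prop))
      (Eventually.of_forall fun k => Eventually.of_forall fun z => ?_)
      (hint.const_mul C) (Eventually.of_forall fun z => ?_)
    · rw [Real.norm_eq_abs, abs_mul, Real.abs_exp]
      exact mul_le_mul_of_nonneg_right (hC _) (Real.exp_pos _).le
    · refine Tendsto.mul_const _ ((hf.tendsto x).comp ?_)
      have h := hy.add (((Real.continuous_sqrt.tendsto 0).comp hσ).smul_const z)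
      simpa using h
  have hval : f x = (2 * π) ^ (-(d : ℝ) / 2) *
      ∫ z : Fin d → ℝ, f x * Real.exp (-(∑ b, z b ^ 2) / 2) := by
    rw [integral_const_mul, integral_exp_neg_half_sum_sq, mul_left_comm,
      ← Real.rpow_add (by positivity), neg_div, neg_add_cancel, Real.rpow_zero, mul_one]
  rw [hval]
  refine (hlim.const_mul _).congr' ?_
  filter_upwards [hpos] with k hk
  exact (heatMean_eq_integral_add_sqrt_smul f (ys k) hk).symm

end HeatMean

/-- for `f` continuous and bounded, the backward mean value
`w(t,x) = ∫ f(y) L(t;x,y) dy` satisfies the backward multitime heat PDEs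
`∂w/∂t^α = -(1/2) c_α(t) Δ_x w` on `{t ∈ ℝ^m_{>0} : t^1⋯t^m < V} × ℝ^d` and the
terminal condition `w(t',y) → f(x)` as `y → x` and `t'^1⋯t'^m → V⁻`. -/
theorem meanValW_backward_heat (m d : ℕ) (hm : 1 ≤ m) (hd : 1 ≤ d)
    (T : Fin m → ℝ) (hT : ∀ α, 0 < T α)
    (f : (Fin d → ℝ) → ℝ) (hf : Continuous f) (hfb : ∃ C : ℝ, ∀ y, |f y| ≤ C) :
    (∀ (α : Fin m) (t : Fin m → ℝ), (∀ β, 0 < t β) → (∏ β, t β) < ∏ β, T β →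
      ∀ x : Fin d → ℝ,
        deriv (fun s => meanValW m d (∏ β, T β) f (Function.update t α s) x) (t α)
          = -(1 / 2) * (∏ β ∈ Finset.univ.erase α, t β) *
              lapX (meanValW m d (∏ β, T β) f t) x)
    ∧ (∀ x : Fin d → ℝ, ∀ (ts : ℕ → Fin m → ℝ) (ys : ℕ → Fin d → ℝ),
        (∀ k α, 0 < ts k α) → (∀ k, (∏ β, ts k β) < ∏ β, T β) →
        Tendsto (fun k => ∏ β, ts k β) atTop (nhds (∏ β, T β)) →
        Tendsto ys atTop (nhds x) →
        Tendsto (fun k => meanValW m d (∏ β, T β) f (ts k) (ys k))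
          atTop (nhds (f x))) := by
  obtain ⟨C, hC⟩ := hfb
  constructor
  · intro α t _ hlt x
    have hprod : ∀ s, ∏ β, Function.update t α s β = s * ∏ β ∈ univ.erase α, t β := by
      intro s
      rw [← Finset.mul_prod_erase _ _ (Finset.mem_univ α), Function.update_self]
      congr 1
      refine Finset.prod_congr rfl fun b hb => ?_
      rw [Function.update_of_ne (Finset.ne_of_mem_erase hb)]
    have hself : t α * ∏ β ∈ univ.erase α, t β = ∏ β, t β :=
      Finset.mul_prod_erase _ _ (Finset.mem_univ α)
    have hσ : 0 < (∏ β, T β) - t α * ∏ β ∈ univ.erase α, t β := by rw [hself]; linarith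
    have hin : HasDerivAt (fun s => (∏ β, T β) - s * ∏ β ∈ univ.erase α, t β)
        (-(∏ β ∈ univ.erase α, t β)) (t α) := by
      simpa using ((hasDerivAt_id (t α)).mul_const (∏ β ∈ univ.erase α, t β)).const_sub (∏ β, T β)
    have hcomp := (hasDerivAt_heatMean hf hC x hσ).comp (t α) hin
    have hw : meanValW m d (∏ β, T β) f t
        = heatMean f ((∏ β, T β) - t α * ∏ β ∈ univ.erase α, t β) := by
      funext z
      rw [meanValW_eq_heatMean, hself]
    simp only [meanValW_eq_heatMean, hprod, hw]
    refine hcomp.deriv.trans ?_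
    ring
  · intro x ts ys _ hlt hlim hy
    simp only [meanValW_eq_heatMean]
    refine tendsto_heatMean hf hC (Eventually.of_forall fun k => sub_pos.2 (hlt k)) ?_ hy
    simpa using hlim.const_sub (∏ β, T β)
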